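/- Bagderina's operators of invariant differentiation coincide with the vector fields 𝐗 and 𝐘 of the earlier classification: at every point (x, y) where A(x,y) ≠ 0, setting μ₁ = −F and μ₂ = Γ₀/(β₁·F⁴), one has μ₁⁻²·β₂ = B/F², μ₁⁻²·(−β₁) = −A/F², μ₂·β₂ − 3·μ₁/β₁ = G/F⁴, and −μ₂·β₁ = H/F⁴; i.e. the operator μ₁⁻²(β₂∂_x − β₁∂_y) has components (B/F², −A/F²) and the operator μ₂(β₂∂_x − β₁∂_y) − 3β₁⁻¹μ₁∂_x has components (G/F⁴, H/F⁴). -/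

import Mathlib

open Function

noncomputable section

/-- Partial derivative in the first variable. -/
def pdx (f : ℝ → ℝ → ℝ) : ℝ → ℝ → ℝ := fun x y => deriv (fun t => f t y) x

/-- Partial derivative in the second variable. -/
def pdy (f : ℝ → ℝ → ℝ) : ℝ → ℝ → ℝ := fun x y => deriv (fun t => f x t) y

def al0 (P Q R S : ℝ → ℝ → ℝ) : ℝ → ℝ → ℝ := fun x y =>
  pdx Q x y - pdy P x y + 2 * P x y * R x y - 2 * Q x y ^ 2

def al1 (P Q R S : ℝ → ℝ → ℝ) : ℝ → ℝ → ℝ := fun x y =>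
  pdx R x y - pdy Q x y + P x y * S x y - Q x y * R x y

def al2 (P Q R S : ℝ → ℝ → ℝ) : ℝ → ℝ → ℝ := fun x y =>
  pdx S x y - pdy R x y + 2 * Q x y * S x y - 2 * R x y ^ 2

def b1 (P Q R S : ℝ → ℝ → ℝ) : ℝ → ℝ → ℝ := fun x y =>
  pdx (al1 P Q R S) x y - pdy (al0 P Q R S) x y + R x y * al0 P Q R S x y - 2 * Q x y * al1 P Q R S x y + P x y * al2 P Q R S x y

def b2 (P Q R S : ℝ → ℝ → ℝ) : ℝ → ℝ → ℝ := fun x y =>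
  pdx (al2 P Q R S) x y - pdy (al1 P Q R S) x y + S x y * al0 P Q R S x y - 2 * R x y * al1 P Q R S x y + Q x y * al2 P Q R S x y

def g10 (P Q R S : ℝ → ℝ → ℝ) : ℝ → ℝ → ℝ := fun x y =>
  pdx (b1 P Q R S) x y - Q x y * b1 P Q R S x y + P x y * b2 P Q R S x y

def g11 (P Q R S : ℝ → ℝ → ℝ) : ℝ → ℝ → ℝ := fun x y =>
  pdx (b2 P Q R S) x y - R x y * b1 P Q R S x y + Q x y * b2 P Q R S x y

def g20 (P Q R S : ℝ → ℝ → ℝ) : ℝ → ℝ → ℝ := fun x y =>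
  pdy (b1 P Q R S) x y - R x y * b1 P Q R S x y + Q x y * b2 P Q R S x y

def g21 (P Q R S : ℝ → ℝ → ℝ) : ℝ → ℝ → ℝ := fun x y =>
  pdy (b2 P Q R S) x y - S x y * b1 P Q R S x y + R x y * b2 P Q R S x y

def J0 (P Q R S : ℝ → ℝ → ℝ) : ℝ → ℝ → ℝ := fun x y =>
  b2 P Q R S x y ^ 2 * g10 P Q R S x y - b1 P Q R S x y * b2 P Q R S x y * (g20 P Q R S x y + g11 P Q R S x y) + b1 P Q R S x y ^ 2 * g21 P Q R S x y

def Gam0 (P Q R S : ℝ → ℝ → ℝ) : ℝ → ℝ → ℝ := fun x y =>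
  3 * b2 P Q R S x y * g10 P Q R S x y + b1 P Q R S x y * (g20 P Q R S x y - 4 * g11 P Q R S x y)

def Gam1 (P Q R S : ℝ → ℝ → ℝ) : ℝ → ℝ → ℝ := fun x y =>
  b2 P Q R S x y * (4 * g20 P Q R S x y - g11 P Q R S x y) - 3 * b1 P Q R S x y * g21 P Q R S x y

def d10 (P Q R S : ℝ → ℝ → ℝ) : ℝ → ℝ → ℝ := fun x y =>
  pdx (g10 P Q R S) x y - 2 * Q x y * g10 P Q R S x y + P x y * (g20 P Q R S x y + g11 P Q R S x y) - 5 * al0 P Q R S x y * b1 P Q R S x y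

def d20 (P Q R S : ℝ → ℝ → ℝ) : ℝ → ℝ → ℝ := fun x y =>
  pdx (g20 P Q R S) x y - R x y * g10 P Q R S x y + P x y * g21 P Q R S x y - 4 * al1 P Q R S x y * b1 P Q R S x y - al0 P Q R S x y * b2 P Q R S x y

def d30 (P Q R S : ℝ → ℝ → ℝ) : ℝ → ℝ → ℝ := fun x y =>
  pdy (g20 P Q R S) x y - S x y * g10 P Q R S x y + Q x y * g21 P Q R S x y - 4 * al2 P Q R S x y * b1 P Q R S x y - al1 P Q R S x y * b2 P Q R S x y

def d11 (P Q R S : ℝ → ℝ → ℝ) : ℝ → ℝ → ℝ := fun x y =>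
  pdx (g11 P Q R S) x y - R x y * g10 P Q R S x y + P x y * g21 P Q R S x y - al1 P Q R S x y * b1 P Q R S x y - 4 * al0 P Q R S x y * b2 P Q R S x y

def d21 (P Q R S : ℝ → ℝ → ℝ) : ℝ → ℝ → ℝ := fun x y =>
  pdx (g21 P Q R S) x y - R x y * (g20 P Q R S x y + g11 P Q R S x y) + 2 * Q x y * g21 P Q R S x y - 5 * al1 P Q R S x y * b2 P Q R S x y

def d31 (P Q R S : ℝ → ℝ → ℝ) : ℝ → ℝ → ℝ := fun x y =>
  pdy (g21 P Q R S) x y - S x y * (g20 P Q R S x y + g11 P Q R S x y) + 2 * R x y * g21 P Q R S x y - 5 * al2 P Q R S x y * b2 P Q R S x y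

def J1 (P Q R S : ℝ → ℝ → ℝ) : ℝ → ℝ → ℝ := fun x y =>
  b2 P Q R S x y * (d20 P Q R S x y - d11 P Q R S x y) + b1 P Q R S x y * (d21 P Q R S x y - d30 P Q R S x y) + (7 / 5) * (g20 P Q R S x y - g11 P Q R S x y) ^ 2 + (3 / 5) * (g20 P Q R S x y * g11 P Q R S x y - g10 P Q R S x y * g21 P Q R S x y)

def J2 (P Q R S : ℝ → ℝ → ℝ) : ℝ → ℝ → ℝ := fun x y =>
  Gam1 P Q R S x y * (d20 P Q R S x y - d11 P Q R S x y) + Gam0 P Q R S x y * (d21 P Q R S x y - d30 P Q R S x y) + 3 * (g20 P Q R S x y - g11 P Q R S x y) * (g10 P Q R S x y * g21 P Q R S x y - g20 P Q R S x y * g11 P Q R S x y) + (4 / 3) * (g20 P Q R S x y - g11 P Q R S x y) ^ 3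

def J3 (P Q R S : ℝ → ℝ → ℝ) : ℝ → ℝ → ℝ := fun x y =>
  b2 P Q R S x y ^ 3 * d10 P Q R S x y - b1 P Q R S x y * b2 P Q R S x y ^ 2 * (2 * d20 P Q R S x y + d11 P Q R S x y) + b1 P Q R S x y ^ 2 * b2 P Q R S x y * (d30 P Q R S x y + 2 * d21 P Q R S x y) - b1 P Q R S x y ^ 3 * d31 P Q R S x y + 4 * (g20 P Q R S x y - g11 P Q R S x y) * J0 P Q R S x y

def J4 (P Q R S : ℝ → ℝ → ℝ) : ℝ → ℝ → ℝ := fun x y =>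
  -b2 P Q R S x y * (b2 P Q R S x y * Gam0 P Q R S x y + 2 * b1 P Q R S x y * Gam1 P Q R S x y) * (2 * d20 P Q R S x y + d11 P Q R S x y) + b1 P Q R S x y * (2 * b2 P Q R S x y * Gam0 P Q R S x y + b1 P Q R S x y * Gam1 P Q R S x y) * (d30 P Q R S x y + 2 * d21 P Q R S x y) + 3 * b2 P Q R S x y ^ 2 * Gam1 P Q R S x y * d10 P Q R S x y - 3 * b1 P Q R S x y ^ 2 * Gam0 P Q R S x y * d31 P Q R S x y + (66 / 5) * (g20 P Q R S x y - g11 P Q R S x y) ^ 2 * J0 P Q R S x y + (36 / 5) * (g10 P Q R S x y * g21 P Q R S x y - g20 P Q R S x y * g11 P Q R S x y) * J0 P Q R S x y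

def AA (P Q R S : ℝ → ℝ → ℝ) : ℝ → ℝ → ℝ := fun x y =>
  pdy (pdy P) x y - 2 * pdx (pdy Q) x y + pdx (pdx R) x y + 2 * P x y * pdx S x y + S x y * pdx P x y - 3 * P x y * pdy R x y - 3 * R x y * pdy P x y - 3 * Q x y * pdx R x y + 6 * Q x y * pdy Q x y

def BB (P Q R S : ℝ → ℝ → ℝ) : ℝ → ℝ → ℝ := fun x y =>
  pdx (pdx S) x y - 2 * pdx (pdy R) x y + pdy (pdy Q) x y - 2 * S x y * pdy P x y - P x y * pdy S x y + 3 * S x y * pdx Q x y + 3 * Q x y * pdx S x y + 3 * R x y * pdy Q x y - 6 * R x y * pdx R x y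

def GG (P Q R S : ℝ → ℝ → ℝ) : ℝ → ℝ → ℝ := fun x y =>
  -BB P Q R S x y * pdx (BB P Q R S) x y - 3 * AA P Q R S x y * pdy (BB P Q R S) x y + 4 * BB P Q R S x y * pdy (AA P Q R S) x y + 3 * S x y * AA P Q R S x y ^ 2 - 6 * R x y * AA P Q R S x y * BB P Q R S x y + 3 * Q x y * BB P Q R S x y ^ 2

def HH (P Q R S : ℝ → ℝ → ℝ) : ℝ → ℝ → ℝ := fun x y =>
  -AA P Q R S x y * pdy (AA P Q R S) x y - 3 * BB P Q R S x y * pdx (AA P Q R S) x y + 4 * AA P Q R S x y * pdx (BB P Q R S) x y - 3 * P x y * BB P Q R S x y ^ 2 + 6 * Q x y * AA P Q R S x y * BB P Q R S x y - 3 * R x y * AA P Q R S x y ^ 2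

def Phi (P Q R S : ℝ → ℝ → ℝ) : ℝ → ℝ → ℝ := fun x y =>
  AA P Q R S x y * BB P Q R S x y * pdy (AA P Q R S) x y + AA P Q R S x y * BB P Q R S x y * pdx (BB P Q R S) x y - AA P Q R S x y ^ 2 * pdy (BB P Q R S) x y - BB P Q R S x y ^ 2 * pdx (AA P Q R S) x y - P x y * BB P Q R S x y ^ 3 + 3 * Q x y * AA P Q R S x y * BB P Q R S x y ^ 2 - 3 * R x y * AA P Q R S x y ^ 2 * BB P Q R S x y + S x y * AA P Q R S x y ^ 3

def I3v (P Q R S F : ℝ → ℝ → ℝ) : ℝ → ℝ → ℝ := fun x y =>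
  BB P Q R S x y * (HH P Q R S x y * pdx (GG P Q R S) x y - GG P Q R S x y * pdx (HH P Q R S) x y) / (3 * F x y ^ 9) - AA P Q R S x y * (HH P Q R S x y * pdy (GG P Q R S) x y - GG P Q R S x y * pdy (HH P Q R S) x y) / (3 * F x y ^ 9) + (HH P Q R S x y * pdy F x y + GG P Q R S x y * pdx F x y) / (3 * F x y ^ 5) + BB P Q R S x y * GG P Q R S x y ^ 2 * P x y / (3 * F x y ^ 9) - (AA P Q R S x y * GG P Q R S x y ^ 2 - 2 * HH P Q R S x y * BB P Q R S x y * GG P Q R S x y) * Q x y / (3 * F x y ^ 9) + (BB P Q R S x y * HH P Q R S x y ^ 2 - 2 * HH P Q R S x y * AA P Q R S x y * GG P Q R S x y) * R x y / (3 * F x y ^ 9) - AA P Q R S x y * HH P Q R S x y ^ 2 * S x y / (3 * F x y ^ 9)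

def I6v (P Q R S F : ℝ → ℝ → ℝ) : ℝ → ℝ → ℝ := fun x y =>
  (pdy (AA P Q R S) x y - pdx (BB P Q R S) x y) / (3 * F x y ^ 2) - (AA P Q R S x y * pdy F x y - BB P Q R S x y * pdx F x y) / (3 * F x y ^ 3)

def I7v (P Q R S F : ℝ → ℝ → ℝ) : ℝ → ℝ → ℝ := fun x y =>
  (GG P Q R S x y * HH P Q R S x y * pdx (GG P Q R S) x y - GG P Q R S x y ^ 2 * pdx (HH P Q R S) x y + HH P Q R S x y ^ 2 * pdy (GG P Q R S) x y - HH P Q R S x y * GG P Q R S x y * pdy (HH P Q R S) x y) / (3 * F x y ^ 11) + (GG P Q R S x y ^ 3 * P x y + 3 * GG P Q R S x y ^ 2 * HH P Q R S x y * Q x y + 3 * GG P Q R S x y * HH P Q R S x y ^ 2 * R x y + HH P Q R S x y ^ 3 * S x y) / (3 * F x y ^ 11)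

def I8v (P Q R S F : ℝ → ℝ → ℝ) : ℝ → ℝ → ℝ := fun x y =>
  GG P Q R S x y * (AA P Q R S x y * pdx (GG P Q R S) x y + BB P Q R S x y * pdx (HH P Q R S) x y) / (3 * F x y ^ 9) + HH P Q R S x y * (AA P Q R S x y * pdy (GG P Q R S) x y + BB P Q R S x y * pdy (HH P Q R S) x y) / (3 * F x y ^ 9) - 10 * (HH P Q R S x y * pdy F x y + GG P Q R S x y * pdx F x y) / (3 * F x y ^ 5) - BB P Q R S x y * GG P Q R S x y ^ 2 * P x y / (3 * F x y ^ 9) + (AA P Q R S x y * GG P Q R S x y ^ 2 - 2 * HH P Q R S x y * BB P Q R S x y * GG P Q R S x y) * Q x y / (3 * F x y ^ 9) - (BB P Q R S x y * HH P Q R S x y ^ 2 - 2 * HH P Q R S x y * AA P Q R S x y * GG P Q R S x y) * R x y / (3 * F x y ^ 9) + AA P Q R S x y * HH P Q R S x y ^ 2 * S x y / (3 * F x y ^ 9)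

def XX (P Q R S F f : ℝ → ℝ → ℝ) : ℝ → ℝ → ℝ := fun x y =>
  (BB P Q R S x y * pdx f x y - AA P Q R S x y * pdy f x y) / F x y ^ 2

def YY (P Q R S F f : ℝ → ℝ → ℝ) : ℝ → ℝ → ℝ := fun x y =>
  (GG P Q R S x y * pdx f x y + HH P Q R S x y * pdy f x y) / F x y ^ 4

def IBgd1 (P Q R S F : ℝ → ℝ → ℝ) : ℝ → ℝ → ℝ := fun x y =>
  J1 P Q R S x y / F x y ^ 4

def IBgd2 (P Q R S F : ℝ → ℝ → ℝ) : ℝ → ℝ → ℝ := fun x y =>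
  J2 P Q R S x y / F x y ^ 6

def IBgd3 (P Q R S F : ℝ → ℝ → ℝ) : ℝ → ℝ → ℝ := fun x y =>
  -(J3 P Q R S x y / F x y ^ 7)

def IBgd4 (P Q R S F : ℝ → ℝ → ℝ) : ℝ → ℝ → ℝ := fun x y =>
  -(J4 P Q R S x y / F x y ^ 9)


/-- Smoothness of a function of two real variables given in curried form. -/
def SmoothTwo (f : ℝ → ℝ → ℝ) : Prop := ContDiff ℝ (⊤ : ℕ∞) (uncurry f)

theorem SmoothTwo.hasDerivAt_fst {f : ℝ → ℝ → ℝ} (hf : SmoothTwo f) (x y : ℝ) :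
    HasDerivAt (fun t => f t y) (fderiv ℝ (uncurry f) (x, y) (1, 0)) x :=
  HasFDerivAt.comp_hasDerivAt (f := fun t => (t, y)) x
    (hf.differentiable (by simp) (x, y)).hasFDerivAt
    ((hasDerivAt_id x).prodMk (hasDerivAt_const x y))

theorem SmoothTwo.hasDerivAt_snd {f : ℝ → ℝ → ℝ} (hf : SmoothTwo f) (x y : ℝ) :
    HasDerivAt (fun t => f x t) (fderiv ℝ (uncurry f) (x, y) (0, 1)) y :=
  HasFDerivAt.comp_hasDerivAt (f := fun t => (x, t)) y
    (hf.differentiable (by simp) (x, y)).hasFDerivAt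
    ((hasDerivAt_const y x).prodMk (hasDerivAt_id y))

theorem SmoothTwo.hasDerivAt_pdx {f : ℝ → ℝ → ℝ} (hf : SmoothTwo f) (x y : ℝ) :
    HasDerivAt (fun t => f t y) (pdx f x y) x :=
  (hf.hasDerivAt_fst x y).differentiableAt.hasDerivAt

theorem SmoothTwo.hasDerivAt_pdy {f : ℝ → ℝ → ℝ} (hf : SmoothTwo f) (x y : ℝ) :
    HasDerivAt (fun t => f x t) (pdy f x y) y :=
  (hf.hasDerivAt_snd x y).differentiableAt.hasDerivAt

theorem SmoothTwo.pdx_eq {f : ℝ → ℝ → ℝ} (hf : SmoothTwo f) (x y : ℝ) :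
    pdx f x y = fderiv ℝ (uncurry f) (x, y) (1, 0) :=
  (hf.hasDerivAt_fst x y).deriv

theorem SmoothTwo.pdy_eq {f : ℝ → ℝ → ℝ} (hf : SmoothTwo f) (x y : ℝ) :
    pdy f x y = fderiv ℝ (uncurry f) (x, y) (0, 1) :=
  (hf.hasDerivAt_snd x y).deriv

theorem SmoothTwo.uncurry_pdx {f : ℝ → ℝ → ℝ} (hf : SmoothTwo f) :
    uncurry (pdx f) = fun p => fderiv ℝ (uncurry f) p (1, 0) :=
  funext fun p => hf.pdx_eq p.1 p.2

theorem SmoothTwo.uncurry_pdy {f : ℝ → ℝ → ℝ} (hf : SmoothTwo f) :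
    uncurry (pdy f) = fun p => fderiv ℝ (uncurry f) p (0, 1) :=
  funext fun p => hf.pdy_eq p.1 p.2

theorem SmoothTwo.smooth_pdx {f : ℝ → ℝ → ℝ} (hf : SmoothTwo f) : SmoothTwo (pdx f) := by
  rw [SmoothTwo, hf.uncurry_pdx]
  exact (ContDiff.fderiv_right hf (by simp)).clm_apply contDiff_const

theorem SmoothTwo.smooth_pdy {f : ℝ → ℝ → ℝ} (hf : SmoothTwo f) : SmoothTwo (pdy f) := by
  rw [SmoothTwo, hf.uncurry_pdy]
  exact (ContDiff.fderiv_right hf (by simp)).clm_apply contDiff_const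

/-- Symmetry of the mixed second partial derivatives. -/
theorem SmoothTwo.pdy_pdx_comm {f : ℝ → ℝ → ℝ} (hf : SmoothTwo f) (x y : ℝ) :
    pdy (pdx f) x y = pdx (pdy f) x y := by
  have hd : DifferentiableAt ℝ (fderiv ℝ (uncurry f)) (x, y) :=
    (ContDiff.fderiv_right (m := (⊤ : ℕ∞)) hf (by simp)).differentiable (by simp) _
  have hsymm : IsSymmSndFDerivAt ℝ (uncurry f) (x, y) :=
    (ContDiff.contDiffAt hf).isSymmSndFDerivAt
      (by simpa using WithTop.coe_le_coe.2 (le_top : (2 : ℕ∞) ≤ ⊤))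
  rw [hf.smooth_pdx.pdy_eq, hf.smooth_pdy.pdx_eq, hf.uncurry_pdx, hf.uncurry_pdy,
    fderiv_clm_apply hd (by fun_prop), fderiv_clm_apply hd (by fun_prop)]
  simpa using hsymm.eq (0, 1) (1, 0)

section

variable {P Q R S : ℝ → ℝ → ℝ}

theorem pdy_al0 (hP : SmoothTwo P) (hQ : SmoothTwo Q) (hR : SmoothTwo R)
    (x y : ℝ) : pdy (al0 P Q R S) x y =
      pdy (pdx Q) x y - pdy (pdy P) x y +
        (2 * (pdy P x y * R x y + P x y * pdy R x y) - 4 * Q x y * pdy Q x y) := by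
  refine HasDerivAt.deriv ?_
  refine HasDerivAt.congr_deriv
    ((((hQ.smooth_pdx.hasDerivAt_pdy x y).sub (hP.smooth_pdy.hasDerivAt_pdy x y)).add
      (((hP.hasDerivAt_pdy x y).const_mul 2).mul (hR.hasDerivAt_pdy x y))).sub
      (((hQ.hasDerivAt_pdy x y).pow 2).const_mul 2)) ?_
  push_cast
  ring

theorem pdx_al1 (hP : SmoothTwo P) (hQ : SmoothTwo Q) (hR : SmoothTwo R) (hS : SmoothTwo S)
    (x y : ℝ) : pdx (al1 P Q R S) x y =
      pdx (pdx R) x y - pdx (pdy Q) x y +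
        (pdx P x y * S x y + P x y * pdx S x y - (pdx Q x y * R x y + Q x y * pdx R x y)) := by
  refine HasDerivAt.deriv ?_
  refine HasDerivAt.congr_deriv
    ((((hR.smooth_pdx.hasDerivAt_pdx x y).sub (hQ.smooth_pdy.hasDerivAt_pdx x y)).add
      ((hP.hasDerivAt_pdx x y).mul (hS.hasDerivAt_pdx x y))).sub
      ((hQ.hasDerivAt_pdx x y).mul (hR.hasDerivAt_pdx x y))) ?_
  ring

theorem pdy_al1 (hP : SmoothTwo P) (hQ : SmoothTwo Q) (hR : SmoothTwo R) (hS : SmoothTwo S)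
    (x y : ℝ) : pdy (al1 P Q R S) x y =
      pdy (pdx R) x y - pdy (pdy Q) x y +
        (pdy P x y * S x y + P x y * pdy S x y - (pdy Q x y * R x y + Q x y * pdy R x y)) := by
  refine HasDerivAt.deriv ?_
  refine HasDerivAt.congr_deriv
    ((((hR.smooth_pdx.hasDerivAt_pdy x y).sub (hQ.smooth_pdy.hasDerivAt_pdy x y)).add
      ((hP.hasDerivAt_pdy x y).mul (hS.hasDerivAt_pdy x y))).sub
      ((hQ.hasDerivAt_pdy x y).mul (hR.hasDerivAt_pdy x y))) ?_
  ring

theorem pdx_al2 (hQ : SmoothTwo Q) (hR : SmoothTwo R) (hS : SmoothTwo S)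
    (x y : ℝ) : pdx (al2 P Q R S) x y =
      pdx (pdx S) x y - pdx (pdy R) x y +
        (2 * (pdx Q x y * S x y + Q x y * pdx S x y) - 4 * R x y * pdx R x y) := by
  refine HasDerivAt.deriv ?_
  refine HasDerivAt.congr_deriv
    ((((hS.smooth_pdx.hasDerivAt_pdx x y).sub (hR.smooth_pdy.hasDerivAt_pdx x y)).add
      (((hQ.hasDerivAt_pdx x y).const_mul 2).mul (hS.hasDerivAt_pdx x y))).sub
      (((hR.hasDerivAt_pdx x y).pow 2).const_mul 2)) ?_
  push_cast
  ring

theorem b1_eq_AA (hP : SmoothTwo P) (hQ : SmoothTwo Q) (hR : SmoothTwo R) (hS : SmoothTwo S) :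
    b1 P Q R S = AA P Q R S := by
  funext x y
  rw [b1, pdx_al1 hP hQ hR hS, pdy_al0 hP hQ hR, hQ.pdy_pdx_comm, al0, al1, al2, AA]
  ring

theorem b2_eq_BB (hP : SmoothTwo P) (hQ : SmoothTwo Q) (hR : SmoothTwo R) (hS : SmoothTwo S) :
    b2 P Q R S = BB P Q R S := by
  funext x y
  rw [b2, pdx_al2 hQ hR hS, pdy_al1 hP hQ hR hS, hR.pdy_pdx_comm, al0, al1, al2, BB]
  ring

theorem Gam0_eq_neg_HH (hP : SmoothTwo P) (hQ : SmoothTwo Q) (hR : SmoothTwo R)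
    (hS : SmoothTwo S) (x y : ℝ) : Gam0 P Q R S x y = -HH P Q R S x y := by
  rw [Gam0, g10, g20, g11, b1_eq_AA hP hQ hR hS, b2_eq_BB hP hQ hR hS, HH]
  ring

theorem three_mul_Phi (P Q R S : ℝ → ℝ → ℝ) (x y : ℝ) :
    3 * Phi P Q R S x y =
      AA P Q R S x y * GG P Q R S x y + BB P Q R S x y * HH P Q R S x y := by
  rw [Phi, GG, HH]
  ring

end

theorem stmt7 (P Q R S : ℝ → ℝ → ℝ)
    (hP : ContDiff ℝ (⊤ : ℕ∞) (uncurry P)) (hQ : ContDiff ℝ (⊤ : ℕ∞) (uncurry Q))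
    (hR : ContDiff ℝ (⊤ : ℕ∞) (uncurry R)) (hS : ContDiff ℝ (⊤ : ℕ∞) (uncurry S)) (F : ℝ → ℝ → ℝ)
    (hF : ContDiff ℝ (⊤ : ℕ∞) (uncurry F)) (hF5 : ∀ x y : ℝ, F x y ^ 5 = Phi P Q R S x y) (hFne : ∀ x y : ℝ, F x y ≠ 0) :
    ∀ x y : ℝ, AA P Q R S x y ≠ 0 →
      ((- F x y) ^ 2)⁻¹ * b2 P Q R S x y = BB P Q R S x y / F x y ^ 2 ∧
      ((- F x y) ^ 2)⁻¹ * (-(b1 P Q R S x y)) = -(AA P Q R S x y) / F x y ^ 2 ∧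
      (Gam0 P Q R S x y / (b1 P Q R S x y * F x y ^ 4)) * b2 P Q R S x y
        - 3 * (- F x y) / b1 P Q R S x y = GG P Q R S x y / F x y ^ 4 ∧
      -(Gam0 P Q R S x y / (b1 P Q R S x y * F x y ^ 4)) * b1 P Q R S x y
        = HH P Q R S x y / F x y ^ 4 := by
  intro x y hA
  have hF0 := hFne x y
  have h3 := three_mul_Phi P Q R S x y
  rw [← hF5 x y] at h3
  rw [Gam0_eq_neg_HH hP hQ hR hS, b1_eq_AA hP hQ hR hS, b2_eq_BB hP hQ hR hS]
  refine ⟨?_, ?_, ?_, ?_⟩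
  · rw [neg_sq, inv_mul_eq_div]
  · rw [neg_sq, inv_mul_eq_div]
  · field_simp
    linear_combination h3
  · field_simp
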